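/- For the family of chains X^{(a)}, define Q_a := sup_{x∈ℓ(a)} (1/π^{(a)}(B_x))·Σ_{b∈B_x} π^{(a)}(B_b)²/(μ^{(a)}_b·π^{(a)}(b)). If Q_a / E[T^a_0] → 0 as a → ∞, then Var(T^a_0 / E[T^a_0]) → 0 as a → ∞; in fact Var(T^a_0/E[T^a_0]) ≤ 2·Q_a/E[T^a_0]. -/

import Mathlib

open MeasureTheory ProbabilityTheory Filter Topology ENNReal

noncomputable section

/-- A discrete-time birth-and-death chain on a countable rooted tree `I`.
The tree is encoded by a root, a parent map and a depth function; the chain is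
encoded by its transition matrix `P` (nonzero only between tree-neighbours and
on the diagonal) and by the laws `law x` of the trajectories started at `x`,
characterised by the cylinder formula.  `invm` is the reversible invariant
probability measure of the chain (positive recurrence). -/
structure TreeChain (I : Type*) [MeasurableSpace I] where
  root : I
  par : I → I
  depth : I → ℕ
  par_root : par root = root
  depth_root : depth root = 0
  depth_eq_zero : ∀ x, depth x = 0 → x = root
  depth_par : ∀ x, x ≠ root → depth x = depth (par x) + 1
  P : I → I → ℝ≥0∞
  P_row : ∀ x, ∑' y, P x y = 1
  P_support : ∀ x y, P x y ≠ 0 → y = x ∨ y = par x ∨ x = par y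
  lam_pos : ∀ x, x ≠ root → P (par x) x ≠ 0
  mu_pos : ∀ x, x ≠ root → P x (par x) ≠ 0
  law : I → Measure (ℕ → I)
  law_prob : ∀ x, IsProbabilityMeasure (law x)
  law_start : ∀ x, law x {ω | ω 0 = x} = 1
  law_cyl : ∀ x (n : ℕ) (γ : ℕ → I), γ 0 = x →
    law x {ω | ∀ i ≤ n, ω i = γ i} = ∏ i ∈ Finset.range n, P (γ i) (γ (i + 1))
  invm : I → ℝ≥0∞
  invm_pos : ∀ x, invm x ≠ 0
  invm_sum : ∑' x, invm x = 1
  invm_rev : ∀ x y, invm x * P x y = invm y * P y x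

/-- The hitting time of `y`, as an extended nonnegative real (`∞` if `y` is never hit). -/
def hitTime {I : Type*} (y : I) (ω : ℕ → I) : ℝ≥0∞ :=
  ⨅ (t : ℕ) (_ : ω t = y), (t : ℝ≥0∞)

namespace TreeChain

variable {I : Type*} [MeasurableSpace I] (c : TreeChain I)

/-- The branch `B_x` stemming from `x`: the set of descendants of `x` (including `x`). -/
def branch (x : I) : Set I := {y | ∃ n, c.par^[n] y = x}

/-- The set `ℓ(x)` of vertices on the path from `x` to the root, the root excluded. -/
def pathToRoot (x : I) : Set I := {y | ∃ i < c.depth x, c.par^[i] x = y}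

/-- The set `σ(x)` of children of `x`. -/
def children (x : I) : Set I := {y | y ≠ c.root ∧ c.par y = x}

/-- `μ_x`, the transition probability from `x` to its parent. -/
def mu (x : I) : ℝ≥0∞ := c.P x (c.par x)

/-- `λ_x`, the transition probability from the parent of `x` to `x`. -/
def lamP (x : I) : ℝ≥0∞ := c.P (c.par x) x

/-- `π(A)`, the invariant mass of a set of vertices. -/
def piSet (A : Set I) : ℝ≥0∞ := ∑' y : A, c.invm (y : I)

/-- `E[T^x_y]`, the expected hitting time of `y` for the chain started at `x`. -/
def ET (x y : I) : ℝ≥0∞ := ∫⁻ ω, hitTime y ω ∂(c.law x)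

/-- `E[(T^x_y)²]`, the second moment of the hitting time of `y` started at `x`. -/
def ET2 (x y : I) : ℝ≥0∞ := ∫⁻ ω, (hitTime y ω) ^ 2 ∂(c.law x)

/-- The normalised hitting time `T^x_y / E[T^x_y]` as a real random variable. -/
def ratio (x y : I) (ω : ℕ → I) : ℝ := (hitTime y ω).toReal / (c.ET x y).toReal

/-- `α(a)`: the child of the root lying on the path from `a` to the root. -/
def alphaVert (a : I) : I := c.par^[c.depth a - 1] a

/-- The drift constant `K_a = sup_{b ∈ B_{α(a)}} μ_b · E[T^b_{p(b)}]`. -/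
def Kdrift (a : I) : ℝ≥0∞ :=
  ⨆ b ∈ c.branch (c.alphaVert a), c.mu b * c.ET b (c.par b)

/-- The global constant `K'_a = sup_{b ∈ I} μ_b · E[T^b_{p(b)}]`. -/
def Kdrift' : ℝ≥0∞ := ⨆ b : I, c.mu b * c.ET b (c.par b)

/-- The quantity `Q_x = π(B_x)⁻¹ · Σ_{b ∈ B_x} π(B_b)²/(μ_b π(b))`. -/
def Qx (x : I) : ℝ≥0∞ :=
  (c.piSet (c.branch x))⁻¹ *
    ∑' b : c.branch x, (c.piSet (c.branch (b : I))) ^ 2 / (c.mu (b : I) * c.invm (b : I))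

/-- `Q_a = sup_{x ∈ ℓ(a)} Q_x`. -/
def Qsup (a : I) : ℝ≥0∞ := ⨆ x ∈ c.pathToRoot a, c.Qx x

/-- `R_a = Σ_{b ∈ ℓ(a)} π(B_b)²/(μ_b π(b))`. -/
def Rsum (a : I) : ℝ≥0∞ :=
  ∑' b : c.pathToRoot a, (c.piSet (c.branch (b : I))) ^ 2 / (c.mu (b : I) * c.invm (b : I))

/-- The set `C_{a,k}`: union over the vertices `a_l`, `k < l ≤ d(a)`, of the path from
`a_k` to the root, of the branches stemming from the children of `a_l` other
than `a_{l-1}`. -/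
def Cset (a : I) (k : ℕ) : Set I :=
  {y | ∃ l, k + 1 ≤ l ∧ l ≤ c.depth a ∧
    ∃ ch, ch ∈ c.children (c.par^[l] a) ∧ ch ≠ c.par^[l - 1] a ∧ y ∈ c.branch ch}

end TreeChain

/-- The strong drift condition `0^ℓ-SD` toward the root, for a family of chains
`c n` with distinguished vertices `a n` (the limit `a → ∞` being `n → ∞`). -/
def StrongDrift {I : ℕ → Type*} [∀ n, MeasurableSpace (I n)]
    (c : ∀ n, TreeChain (I n)) (a : ∀ n, I n) : Prop :=
  (∃ Kmu : ℝ≥0∞, 0 < Kmu ∧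
      ∀ n, ∀ b ∈ (c n).branch ((c n).alphaVert (a n)), Kmu ≤ (c n).mu b) ∧
  Tendsto (fun n => ((c n).Kdrift (a n)) ^ 2 / (c n).ET (a n) (c n).root) atTop (𝓝 0)


namespace TreeChain

variable {I : Type*} [MeasurableSpace I] (c : TreeChain I)

theorem P_rev_ne_zero {x y : I} (h : c.P x y ≠ 0) : c.P y x ≠ 0 := by
  intro h0
  have := c.invm_rev x y
  rw [h0, mul_zero] at this
  exact mul_ne_zero (c.invm_pos x) h this

theorem depth_iterate_par (k : ℕ) (x : I) : c.depth (c.par^[k] x) = c.depth x - k := by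
  induction k generalizing x with
  | zero => simp
  | succ k ih =>
    rw [Function.iterate_succ_apply, ih]
    by_cases h : x = c.root
    · rw [h, c.par_root, c.depth_root]; omega
    · rw [c.depth_par x h]; omega

theorem mem_branch_self (x : I) : x ∈ c.branch x := ⟨0, rfl⟩

theorem mem_branch_of_par_mem {x y : I} (h : c.par y ∈ c.branch x) : y ∈ c.branch x := by
  obtain ⟨n, hn⟩ := h
  exact ⟨n + 1, hn⟩

theorem branch_trans {x y z : I} (hy : y ∈ c.branch x) (hz : z ∈ c.branch y) :
    z ∈ c.branch x := by
  obtain ⟨n, rfl⟩ := hy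
  obtain ⟨m, rfl⟩ := hz
  exact ⟨n + m, Function.iterate_add_apply _ _ _ _⟩

theorem par_notMem_branch {x : I} (hx : x ≠ c.root) : c.par x ∉ c.branch x := by
  rintro ⟨n, hn⟩
  have h1 := c.depth_iterate_par n (c.par x)
  have h2 := c.depth_par x hx
  rw [hn] at h1
  omega

theorem ne_root_of_mem_branch {x z : I} (hx : x ≠ c.root) (hz : z ∈ c.branch x) :
    z ≠ c.root := by
  rintro rfl
  obtain ⟨n, hn⟩ := hz
  rw [Function.iterate_fixed c.par_root] at hn
  exact hx hn.symm

/-- The only edge leaving a branch is the one joining its stem to its parent. -/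
theorem eq_of_exit_branch {x z y : I} (hz : z ∈ c.branch x) (hy : y ∉ c.branch x)
    (h : c.P z y ≠ 0) : z = x ∧ y = c.par x := by
  rcases c.P_support z y h with h | h | h
  · exact absurd (h ▸ hz) hy
  · obtain ⟨n, hn⟩ := hz
    cases n with
    | zero => exact ⟨hn, by rw [h]; exact congrArg c.par hn⟩
    | succ n => exact absurd ⟨n, by rw [h]; exact hn⟩ hy
  · exact absurd (c.mem_branch_of_par_mem (h ▸ hz)) hy

theorem invm_ne_top (x : I) : c.invm x ≠ ∞ :=
  ne_top_of_le_ne_top one_ne_top (c.invm_sum ▸ ENNReal.le_tsum x)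

theorem P_le_one (x y : I) : c.P x y ≤ 1 := c.P_row x ▸ ENNReal.le_tsum y

theorem mu_mul_invm_ne_zero {x : I} (hx : x ≠ c.root) : c.mu x * c.invm x ≠ 0 :=
  mul_ne_zero (c.mu_pos x hx) (c.invm_pos x)

theorem mu_mul_invm_ne_top (x : I) : c.mu x * c.invm x ≠ ∞ :=
  mul_ne_top (ne_top_of_le_ne_top one_ne_top (c.P_le_one _ _)) (c.invm_ne_top x)

theorem piSet_ne_top (A : Set I) : c.piSet A ≠ ∞ :=
  ne_top_of_le_ne_top one_ne_top
    (c.invm_sum ▸ ENNReal.tsum_comp_le_tsum_of_injective Subtype.val_injective _)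

theorem piSet_branch_ne_zero (x : I) : c.piSet (c.branch x) ≠ 0 := by
  intro h
  exact c.invm_pos x (ENNReal.tsum_eq_zero.1 h ⟨x, c.mem_branch_self x⟩)

/-- The sum of `f` over a branch, weighted by the invariant measure. -/
def branchSum (x : I) (f : I → ℝ≥0∞) : ℝ≥0∞ := ∑' z : c.branch x, c.invm z * f z

theorem branchSum_mono {x : I} {f g : I → ℝ≥0∞} (h : ∀ z ∈ c.branch x, f z ≤ g z) :
    c.branchSum x f ≤ c.branchSum x g :=
  ENNReal.tsum_le_tsum fun z => mul_le_mul_right (h z z.2) _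

theorem branchSum_add (x : I) (f g : I → ℝ≥0∞) :
    c.branchSum x (fun z => f z + g z) = c.branchSum x f + c.branchSum x g := by
  simp only [branchSum, mul_add, ENNReal.tsum_add]

theorem branchSum_const (x : I) (k : ℝ≥0∞) :
    c.branchSum x (fun _ => k) = c.piSet (c.branch x) * k := by
  simp only [branchSum, ENNReal.tsum_mul_right, piSet]

theorem branchSum_const_mul (x : I) (k : ℝ≥0∞) (f : I → ℝ≥0∞) :
    c.branchSum x (fun z => k * f z) = k * c.branchSum x f := by
  simp only [branchSum, mul_left_comm _ k, ENNReal.tsum_mul_left]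

/-- Mass balance of a branch after one step of the stationary chain. -/
theorem flow_branch {x : I} (hx : x ≠ c.root) (y : I) :
    (∑' z : c.branch x, c.invm z * c.P z y)
        + (({x} : Set I).indicator (fun _ => c.mu x * c.invm x) y)
      = (c.branch x).indicator c.invm y
        + ({c.par x} : Set I).indicator (fun _ => c.mu x * c.invm x) y := by
  have hcomm : (∑' z : c.branch x, c.invm z * c.P z y)
      = ∑' z, (c.branch x).indicator (fun z => c.invm y * c.P y z) z := by
    rw [← tsum_subtype]
    exact tsum_congr fun z => c.invm_rev _ _
  rw [hcomm]
  by_cases hy : y ∈ c.branch x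
  · have hyp : y ∉ ({c.par x} : Set I) := by
      rintro rfl
      exact c.par_notMem_branch hx hy
    rw [Set.indicator_of_notMem hyp, add_zero, Set.indicator_of_mem hy]
    have hrow : c.invm y = ∑' z, c.invm y * c.P y z := by
      rw [ENNReal.tsum_mul_left, c.P_row, mul_one]
    conv_rhs => rw [hrow]
    have hout : ({x} : Set I).indicator (fun _ => c.mu x * c.invm x) y
        = ∑' z, (c.branch x)ᶜ.indicator (fun z => c.invm y * c.P y z) z := by
      rw [tsum_eq_single (c.par x)]
      · rw [Set.indicator_of_mem
          (show c.par x ∈ (c.branch x)ᶜ from c.par_notMem_branch hx)]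
        by_cases hyx : y = x
        · subst hyx
          simp [mu, mul_comm]
        · rw [Set.indicator_of_notMem (by simpa using hyx)]
          by_contra h
          exact hyx (c.eq_of_exit_branch hy (c.par_notMem_branch hx)
            (right_ne_zero_of_mul (Ne.symm h))).1
      · intro z hz
        by_contra h
        have hzB := Set.mem_of_indicator_ne_zero h
        rw [Set.indicator_of_mem hzB] at h
        exact hz (c.eq_of_exit_branch hy hzB (right_ne_zero_of_mul h)).2
    rw [hout, ← ENNReal.tsum_add]
    exact tsum_congr fun z => congrFun (Set.indicator_self_add_compl (c.branch x) _) z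
  · have hyx : y ∉ ({x} : Set I) := by
      rintro rfl
      exact hy (c.mem_branch_self _)
    rw [Set.indicator_of_notMem hyx, Set.indicator_of_notMem hy, add_zero, zero_add,
      tsum_eq_single x]
    · rw [Set.indicator_of_mem (c.mem_branch_self x)]
      by_cases hyp : y = c.par x
      · subst hyp
        rw [Set.indicator_of_mem (Set.mem_singleton _), c.invm_rev, mul_comm, mu]
      · rw [Set.indicator_of_notMem (by simpa using hyp)]
        by_contra h
        exact hyp (c.eq_of_exit_branch (c.mem_branch_self x) hy
          (c.P_rev_ne_zero (right_ne_zero_of_mul h))).2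
    · intro z hz
      by_contra h
      have hzB := Set.mem_of_indicator_ne_zero h
      rw [Set.indicator_of_mem hzB] at h
      exact hz (c.eq_of_exit_branch hzB hy (c.P_rev_ne_zero (right_ne_zero_of_mul h))).1

/-- Green's identity on a branch. -/
theorem branchSum_step {x : I} (hx : x ≠ c.root) (f : I → ℝ≥0∞) :
    c.branchSum x (fun z => ∑' y, c.P z y * f y) + c.mu x * c.invm x * f x
      = c.branchSum x f + c.mu x * c.invm x * f (c.par x) := by
  have hpt : ∀ (w : I), c.mu x * c.invm x * f w
      = ∑' y, ({w} : Set I).indicator (fun _ => c.mu x * c.invm x) y * f y := by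
    intro w
    rw [tsum_eq_single w (fun y hy => by simp [hy])]
    simp
  have h1 : c.branchSum x (fun z => ∑' y, c.P z y * f y)
      = ∑' y, (∑' z : c.branch x, c.invm z * c.P z y) * f y := by
    simp only [branchSum, ← ENNReal.tsum_mul_left, ← ENNReal.tsum_mul_right, mul_assoc]
    exact ENNReal.tsum_comm
  have h2 : c.branchSum x f = ∑' y, (c.branch x).indicator c.invm y * f y := by
    rw [branchSum, tsum_subtype (c.branch x) (fun z => c.invm z * f z)]
    exact tsum_congr fun y => by by_cases hy : y ∈ c.branch x <;> simp [hy]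
  rw [h1, h2, hpt x, hpt (c.par x), ← ENNReal.tsum_add, ← ENNReal.tsum_add]
  exact tsum_congr fun y => by rw [← add_mul, ← add_mul, c.flow_branch hx]

/-- A bounded subsolution of `f = g + P f` on a branch grows across the stem by at most
the mass of `g`. -/
theorem le_of_le_step {x : I} (hx : x ≠ c.root) {f g : I → ℝ≥0∞} {K : ℝ≥0∞} (hK : K ≠ ∞)
    (hfK : ∀ z, f z ≤ K)
    (hfg : ∀ z ∈ c.branch x, f z ≤ g z + ∑' y, c.P z y * f y) :
    f x ≤ f (c.par x) + c.branchSum x g / (c.mu x * c.invm x) := by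
  have hfin : c.branchSum x (fun z => ∑' y, c.P z y * f y) ≠ ∞ := by
    refine ne_top_of_le_ne_top (mul_ne_top (c.piSet_ne_top (c.branch x)) hK)
      (c.branchSum_const x K ▸ c.branchSum_mono fun z _ => ?_)
    calc ∑' y, c.P z y * f y ≤ ∑' y, c.P z y * K :=
          ENNReal.tsum_le_tsum fun y => mul_le_mul_right (hfK y) _
      _ = K := by rw [ENNReal.tsum_mul_right, c.P_row, one_mul]
  have hle : c.mu x * c.invm x * f x ≤ c.branchSum x g + c.mu x * c.invm x * f (c.par x) := by
    refine (ENNReal.add_le_add_iff_left hfin).1 ?_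
    rw [c.branchSum_step hx, ← add_assoc]
    refine add_le_add_left ?_ _
    rw [add_comm, ← c.branchSum_add]
    exact c.branchSum_mono hfg
  have h0 := c.mu_mul_invm_ne_zero hx
  have ht := c.mu_mul_invm_ne_top x
  rw [← ENNReal.mul_le_mul_iff_right h0 ht, mul_add, ENNReal.mul_div_cancel h0 ht, add_comm]
  exact hle

/-- An integrable solution of `f = g + P f` on a branch grows across the stem by
the mass of `g`. -/
theorem eq_of_eq_step {x : I} (hx : x ≠ c.root) {f g : I → ℝ≥0∞}
    (hf : c.branchSum x f ≠ ∞)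
    (hfg : ∀ z ∈ c.branch x, f z = g z + ∑' y, c.P z y * f y) :
    f x = f (c.par x) + c.branchSum x g / (c.mu x * c.invm x) := by
  have hsum : c.branchSum x f
      = c.branchSum x g + c.branchSum x (fun z => ∑' y, c.P z y * f y) := by
    rw [← c.branchSum_add]
    exact tsum_congr fun z => by rw [hfg z z.2]
  have heq : c.mu x * c.invm x * f x
      = c.branchSum x g + c.mu x * c.invm x * f (c.par x) := by
    refine (ENNReal.add_right_inj hf).1 ?_
    conv_lhs => rw [hsum, add_assoc, c.branchSum_step hx]
    ring
  have h0 := c.mu_mul_invm_ne_zero hx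
  have ht := c.mu_mul_invm_ne_top x
  rw [← ENNReal.mul_right_inj h0 ht, mul_add, ENNReal.mul_div_cancel h0 ht, add_comm]
  exact heq

/-- The expected time to reach the parent of `b` from `b`. -/
def stemTime (b : I) : ℝ≥0∞ := c.piSet (c.branch b) / (c.mu b * c.invm b)

theorem le_add_tsum_stemTime {x : I} (hx : x ≠ c.root) {f : I → ℝ≥0∞}
    (hf : ∀ z ∈ c.branch x, f z ≤ f (c.par z) + c.stemTime z) {z : I} (hz : z ∈ c.branch x) :
    f z ≤ f (c.par x)
      + ∑' b : c.branch x, (c.branch (b : I)).indicator (fun _ => c.stemTime b) z := by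
  obtain ⟨k, hk⟩ := hz
  induction k generalizing z with
  | zero =>
    obtain rfl : z = x := hk
    refine (hf z (c.mem_branch_self z)).trans (add_le_add_right ?_ _)
    refine le_trans ?_ (ENNReal.le_tsum ⟨z, c.mem_branch_self z⟩)
    rw [Set.indicator_of_mem (c.mem_branch_self z)]
  | succ k ih =>
    have hz : z ∈ c.branch x := ⟨k + 1, hk⟩
    have hzr := c.ne_root_of_mem_branch hx hz
    have hsingle : c.stemTime z = ∑' b : c.branch x,
        ({⟨z, hz⟩} : Set (c.branch x)).indicator (fun b => c.stemTime b) b := by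
      rw [tsum_eq_single ⟨z, hz⟩ (fun b hb => by simp [hb])]
      simp
    refine (hf z hz).trans ?_
    refine (add_le_add_left (ih hk) _).trans ?_
    rw [add_assoc, hsingle, ← ENNReal.tsum_add]
    refine add_le_add_right (ENNReal.tsum_le_tsum fun b => ?_) _
    by_cases hbz : b = ⟨z, hz⟩
    · subst hbz
      rw [Set.indicator_of_notMem (c.par_notMem_branch hzr),
        Set.indicator_of_mem (Set.mem_singleton _),
        Set.indicator_of_mem (c.mem_branch_self z), zero_add]
    · rw [Set.indicator_of_notMem (s := {(⟨z, hz⟩ : c.branch x)}) hbz, add_zero]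
      by_cases hb : c.par z ∈ c.branch (b : I)
      · rw [Set.indicator_of_mem hb, Set.indicator_of_mem (c.mem_branch_of_par_mem hb)]
      · rw [Set.indicator_of_notMem hb]
        exact zero_le

theorem branchSum_tsum_stemTime (x : I) :
    c.branchSum x (fun z => ∑' b : c.branch x,
        (c.branch (b : I)).indicator (fun _ => c.stemTime b) z)
      = c.piSet (c.branch x) * c.Qx x := by
  rw [Qx, ← mul_assoc, ENNReal.mul_inv_cancel (c.piSet_branch_ne_zero x) (c.piSet_ne_top _),
    one_mul, branchSum]
  simp only [← ENNReal.tsum_mul_left]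
  rw [ENNReal.tsum_comm]
  refine tsum_congr fun b => ?_
  have hset : ∀ z : I, (c.branch (b : I)).indicator (fun z => c.invm z) z * c.stemTime b
      = (c.branch x).indicator
        (fun z => c.invm z * (c.branch (b : I)).indicator (fun _ => c.stemTime b) z) z := by
    intro z
    by_cases hz : z ∈ c.branch (b : I)
    · simp [hz, c.branch_trans b.2 hz]
    · rw [Set.indicator_of_notMem hz, zero_mul, eq_comm, Set.indicator_apply_eq_zero]
      intro _
      rw [Set.indicator_of_notMem hz, mul_zero]
  rw [tsum_subtype (c.branch x)
    (fun z => c.invm z * (c.branch (b : I)).indicator (fun _ => c.stemTime b) z)]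
  simp only [← hset]
  rw [ENNReal.tsum_mul_right, ← tsum_subtype, stemTime, sq, mul_div_assoc]
  rfl

end TreeChain

/-- Measurable sets of a product do not distinguish points whose coordinates are not
distinguished by measurable sets. -/
theorem MeasurableSet.mem_iff_of_forall_mem_iff {ι I : Type*} [MeasurableSpace I] {S : Set (ι → I)}
    (hS : MeasurableSet S) {ω ω' : ι → I}
    (h : ∀ i (s : Set I), MeasurableSet s → (ω i ∈ s ↔ ω' i ∈ s)) : ω ∈ S ↔ ω' ∈ S := by
  let m : MeasurableSpace (ι → I) :=
    { MeasurableSet' := fun S => ω ∈ S ↔ ω' ∈ S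
      measurableSet_empty := Iff.rfl
      measurableSet_compl := fun _ hS => not_congr hS
      measurableSet_iUnion := fun f hf => by simp only [Set.mem_iUnion, hf] }
  have hle : MeasurableSpace.pi ≤ m := by
    refine iSup_le fun i => ?_
    rintro _ ⟨t, ht, rfl⟩
    exact h i t ht
  exact hle S hS

namespace TreeChain

variable {I : Type*} [MeasurableSpace I] (c : TreeChain I)

theorem exists_P_ne_zero_of_ne {x y : I} (hxy : x ≠ y) : ∃ z, c.P z x ≠ 0 := by
  by_cases hx : x = c.root
  · have hstep : ∀ n (w : I), c.depth w = n + 1 → ∃ v, v ≠ c.root ∧ c.par v = c.root := by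
      intro n
      induction n with
      | zero =>
        intro w hw
        have hwr : w ≠ c.root := by rintro rfl; simp [c.depth_root] at hw
        refine ⟨w, hwr, c.depth_eq_zero _ ?_⟩
        have := c.depth_par w hwr
        omega
      | succ n ih =>
        intro w hw
        have hwr : w ≠ c.root := by rintro rfl; simp [c.depth_root] at hw
        refine ih (c.par w) ?_
        have := c.depth_par w hwr
        omega
    have hy : y ≠ c.root := fun h => hxy (hx.trans h.symm)
    obtain ⟨v, hv, hvp⟩ := hstep _ y (c.depth_par y hy)
    exact ⟨v, by rw [hx, ← hvp]; exact c.mu_pos v hv⟩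
  · exact ⟨c.par x, c.lam_pos x hx⟩

theorem law_step (x y : I) : c.law x {ω | ω 0 = x ∧ ω 1 = y} = c.P x y := by
  have h := c.law_cyl x 1 (fun i => if i = 0 then x else y) rfl
  simp only [Finset.prod_range_one, if_true, zero_add, one_ne_zero, if_false] at h
  rw [← h]
  congr 1
  ext ω
  refine ⟨fun hω i hi => ?_, fun hω => ⟨hω 0 (by omega), hω 1 le_rfl⟩⟩
  interval_cases i
  · exact hω.1
  · exact hω.2

/-- A state which is not separated by the `σ`-algebra from another one cannot be reached. -/
theorem P_eq_zero_of_inseparable [Countable I] {x y : I} (hxy : x ≠ y)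
    (h : ∀ s : Set I, MeasurableSet s → (x ∈ s ↔ y ∈ s)) (z : I) : c.P z y = 0 := by
  have := c.law_prob z
  set A : Set (ℕ → I) := ⋃ w : {w // w ≠ y}, {ω | ω 0 = z ∧ ω 1 = w} with hA
  have hsub : {ω : ℕ → I | ω 0 = z} ⊆ toMeasurable (c.law z) A := by
    intro ω hω
    by_cases hω1 : ω 1 = y
    · refine ((measurableSet_toMeasurable _ _).mem_iff_of_forall_mem_iff
        (ω' := Function.update ω 1 x) fun i s hs => ?_).2
        (subset_toMeasurable _ _ (Set.mem_iUnion.2 ⟨⟨x, hxy⟩, by simpa using hω, by simp⟩))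
      by_cases hi : i = 1
      · subst hi
        rw [hω1, Function.update_self, h s hs]
      · rw [Function.update_of_ne hi]
    · exact subset_toMeasurable _ _ (Set.mem_iUnion.2 ⟨⟨ω 1, hω1⟩, hω, rfl⟩)
  have hle : 1 ≤ ∑' w : {w // w ≠ y}, c.P z w := by
    calc 1 = c.law z {ω | ω 0 = z} := (c.law_start z).symm
      _ ≤ c.law z A := (measure_mono hsub).trans (measure_toMeasurable _).le
      _ ≤ ∑' w : {w // w ≠ y}, c.law z {ω | ω 0 = z ∧ ω 1 = w} := measure_iUnion_le _
      _ = _ := tsum_congr fun w => c.law_step z w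
  have hsplit : c.P z y + ∑' w : {w // w ≠ y}, c.P z w = 1 := by
    rw [← c.P_row z, ← ENNReal.summable.tsum_add_tsum_compl (s := {y}) ENNReal.summable,
      tsum_singleton y (c.P z)]
    rfl
  have hle' : c.P z y + 1 ≤ 0 + 1 := by
    rw [zero_add]
    exact (add_le_add_right hle _).trans hsplit.le
  exact le_zero_iff.1 ((ENNReal.add_le_add_iff_right one_ne_top).1 hle')

/-- The cylinder formula forces the `σ`-algebra of the state space to be discrete. -/
theorem measurableSingletonClass {I : Type*} [MeasurableSpace I] (c : TreeChain I) [Countable I] :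
    MeasurableSingletonClass I := by
  refine ⟨fun x => ?_⟩
  have hx : measurableAtom x = {x} := by
    refine Set.eq_singleton_iff_unique_mem.2 ⟨mem_measurableAtom_self x, fun y hy => ?_⟩
    by_contra hne
    obtain ⟨z, hz⟩ := c.exists_P_ne_zero_of_ne hne
    refine hz (c.P_eq_zero_of_inseparable (Ne.symm hne)
      (fun s hs => ⟨fun hxs => ?_, fun hys => ?_⟩) z)
    · exact measurableAtom_subset hs hxs hy
    · by_contra hxs
      exact measurableAtom_subset hs.compl hxs hy hys
  exact hx ▸ MeasurableSet.measurableAtom_of_countable x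

end TreeChain

/-- The cylinder of the trajectories which agree with `γ` up to time `n`. -/
def pathCylinder {I : Type*} (n : ℕ) (γ : ℕ → I) : Set (ℕ → I) := {ω | ∀ i ≤ n, ω i = γ i}

theorem isPiSystem_range_pathCylinder {I : Type*} :
    IsPiSystem {s : Set (ℕ → I) | ∃ n γ, pathCylinder n γ = s} := by
  rintro _ ⟨n, γ, rfl⟩ _ ⟨m, δ, rfl⟩ ⟨η, hη, hη'⟩
  refine ⟨max n m, η, ?_⟩
  ext ω
  refine ⟨fun h => ⟨fun i hi => ?_, fun i hi => ?_⟩, fun h i hi => ?_⟩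
  · rw [h i (le_max_of_le_left hi), hη i hi]
  · rw [h i (le_max_of_le_right hi), hη' i hi]
  · rcases le_max_iff.1 hi with hi | hi
    · rw [h.1 i hi, hη i hi]
    · rw [h.2 i hi, hη' i hi]

theorem measurableSet_pathCylinder {I : Type*} [MeasurableSpace I] [MeasurableSingletonClass I]
    (n : ℕ) (γ : ℕ → I) : MeasurableSet (pathCylinder n γ) := by
  have : pathCylinder n γ = ⋂ i ∈ Set.Iic n, (fun ω : ℕ → I => ω i) ⁻¹' {γ i} := by
    ext ω; simp [pathCylinder]
  rw [this]
  exact MeasurableSet.biInter (Set.to_countable _)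
    fun i _ => measurable_pi_apply i (measurableSet_singleton _)

theorem generateFrom_range_pathCylinder {I : Type*} [MeasurableSpace I] [Countable I]
    [MeasurableSingletonClass I] :
    (MeasurableSpace.pi : MeasurableSpace (ℕ → I))
      = MeasurableSpace.generateFrom {s : Set (ℕ → I) | ∃ n γ, pathCylinder n γ = s} := by
  refine le_antisymm ?_ (MeasurableSpace.generateFrom_le ?_)
  · refine iSup_le fun i => ?_
    rintro _ ⟨t, -, rfl⟩
    have : (fun ω : ℕ → I => ω i) ⁻¹' t
        = ⋃ γ : {γ : Fin (i + 1) → I // γ (Fin.last i) ∈ t},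
          pathCylinder i (fun j => γ.1 (Fin.ofNat (i + 1) j)) := by
      ext ω
      simp only [Set.mem_preimage, Set.mem_iUnion]
      constructor
      · intro h
        refine ⟨⟨fun j => ω j, by simpa using h⟩, fun j hj => ?_⟩
        simp [Nat.mod_eq_of_lt (Nat.lt_succ_of_le hj)]
      · rintro ⟨⟨γ, hγ⟩, h⟩
        rw [h i le_rfl]
        convert hγ
        ext
        simp
    rw [this]
    exact MeasurableSet.iUnion fun γ => MeasurableSpace.measurableSet_generateFrom ⟨_, _, rfl⟩
  · rintro _ ⟨n, γ, rfl⟩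
    exact measurableSet_pathCylinder n γ

/-- The trajectory seen from time `1` on. -/
def pathShift {I : Type*} (ω : ℕ → I) : ℕ → I := fun i => ω (i + 1)

theorem measurable_pathShift {I : Type*} [MeasurableSpace I] :
    Measurable (pathShift : (ℕ → I) → ℕ → I) :=
  measurable_pi_lambda _ fun i => measurable_pi_apply (i + 1)

theorem measurable_hitTime {I : Type*} [MeasurableSpace I] [MeasurableSingletonClass I] (y : I) :
    Measurable (hitTime y) := by
  classical
  refine Measurable.iInf fun t => ?_
  have : (fun ω : ℕ → I => ⨅ _ : ω t = y, (t : ℝ≥0∞))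
      = fun ω => if ω t = y then (t : ℝ≥0∞) else ∞ := by
    funext ω
    split_ifs with h <;> simp [h]
  rw [this]
  exact Measurable.ite
    ((measurable_pi_apply t : Measurable fun ω : ℕ → I => ω t) (measurableSet_singleton y))
    measurable_const measurable_const

theorem hitTime_of_eq {I : Type*} {y : I} {ω : ℕ → I} (h : ω 0 = y) : hitTime y ω = 0 :=
  le_zero_iff.1 ((iInf₂_le 0 h).trans (by simp))

theorem hitTime_of_ne {I : Type*} {y : I} {ω : ℕ → I} (h : ω 0 ≠ y) :
    hitTime y ω = 1 + hitTime y (pathShift ω) := by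
  refine le_antisymm ?_ (le_iInf₂ fun t ht => ?_)
  · simp only [hitTime, ENNReal.add_iInf]
    refine le_iInf₂ fun t ht => (iInf₂_le (t + 1) ht).trans ?_
    push_cast
    rw [add_comm]
  · cases t with
    | zero => exact absurd ht h
    | succ t =>
      push_cast
      rw [add_comm]
      exact add_le_add_left (iInf₂_le t ht) _

namespace TreeChain

variable {I : Type*} [MeasurableSpace I] (c : TreeChain I)

theorem law_ae_start [Countable I] (x : I) : ∀ᵐ ω ∂c.law x, ω 0 = x := by
  have := c.law_prob x
  have := c.measurableSingletonClass
  refine (prob_compl_eq_zero_iff ?_).2 (c.law_start x)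
  exact (measurable_pi_apply 0 : Measurable fun ω : ℕ → I => ω 0) (measurableSet_singleton x)

/-- The Markov property at time `1`. -/
theorem map_pathShift_law [Countable I] (x : I) :
    (c.law x).map pathShift = Measure.sum fun y => c.P x y • c.law y := by
  have := c.law_prob
  have := c.measurableSingletonClass
  have := Measure.isProbabilityMeasure_map (μ := c.law x)
    (measurable_pathShift (I := I)).aemeasurable
  refine ext_of_generate_finite _ generateFrom_range_pathCylinder isPiSystem_range_pathCylinder
    ?_ ?_
  · rintro _ ⟨n, γ, rfl⟩
    have hmeas := measurableSet_pathCylinder n γ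
    rw [Measure.map_apply measurable_pathShift hmeas, Measure.sum_apply _ hmeas,
      tsum_eq_single (γ 0)]
    · have hcyl := c.law_cyl x (n + 1) (fun i => Nat.casesOn i x γ) rfl
      rw [Finset.prod_range_succ'] at hcyl
      rw [Measure.smul_apply, pathCylinder, c.law_cyl (γ 0) n γ rfl, smul_eq_mul, mul_comm]
      refine Eq.trans (measure_congr ?_) hcyl
      filter_upwards [c.law_ae_start x] with ω hω
      refine propext ⟨fun h i hi => ?_, fun h i hi => h (i + 1) (by omega)⟩
      cases i with
      | zero => exact hω
      | succ i => exact h i (by omega)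
    · intro y hy
      rw [Measure.smul_apply, smul_eq_mul]
      refine mul_eq_zero_of_right _ (measure_mono_null (t := {ω | ω 0 = y}ᶜ) ?_
        (mem_ae_iff.1 (c.law_ae_start y)))
      exact fun ω hω h => hy (Eq.trans (Eq.symm h) (hω 0 zero_le))
  · rw [measure_univ, Measure.sum_apply _ MeasurableSet.univ]
    simp [c.P_row]

theorem lintegral_pathShift [Countable I] (x : I) {F : (ℕ → I) → ℝ≥0∞} (hF : Measurable F) :
    ∫⁻ ω, F (pathShift ω) ∂c.law x = ∑' y, c.P x y * ∫⁻ ω, F ω ∂c.law y := by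
  rw [← lintegral_map hF measurable_pathShift, c.map_pathShift_law, lintegral_sum_measure]
  simp [lintegral_smul_measure]

end TreeChain

namespace TreeChain

variable {I : Type*} [MeasurableSpace I] (c : TreeChain I)

theorem ET_eq_step [Countable I] {x : I} (hx : x ≠ c.root) :
    c.ET x c.root = 1 + ∑' y, c.P x y * c.ET y c.root := by
  have := c.law_prob x
  have := c.measurableSingletonClass
  have hT : Measurable (hitTime c.root) := measurable_hitTime c.root
  have h : c.ET x c.root = ∫⁻ ω, (1 + hitTime c.root (pathShift ω)) ∂c.law x := by
    refine lintegral_congr_ae ?_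
    filter_upwards [c.law_ae_start x] with ω hω
    exact hitTime_of_ne (hω ▸ hx)
  rw [h, lintegral_add_left measurable_const, lintegral_const, measure_univ, mul_one,
    c.lintegral_pathShift x hT]
  rfl

/-- The expectation of `min T n`, where `T` is the hitting time of the root. -/
def truncET (n : ℕ) (x : I) : ℝ≥0∞ := ∫⁻ ω, min (hitTime c.root ω) n ∂c.law x

/-- The second moment of `min T n`, where `T` is the hitting time of the root. -/
def truncET2 (n : ℕ) (x : I) : ℝ≥0∞ := ∫⁻ ω, (min (hitTime c.root ω) n) ^ 2 ∂c.law x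

theorem truncET_le (n : ℕ) (x : I) : c.truncET n x ≤ n := by
  have := c.law_prob x
  calc c.truncET n x ≤ ∫⁻ _, (n : ℝ≥0∞) ∂c.law x := lintegral_mono fun ω => min_le_right _ _
    _ = n := by simp

theorem truncET2_le (n : ℕ) (x : I) : c.truncET2 n x ≤ (n : ℝ≥0∞) ^ 2 := by
  have := c.law_prob x
  calc c.truncET2 n x ≤ ∫⁻ _, (n : ℝ≥0∞) ^ 2 ∂c.law x :=
        lintegral_mono fun ω => pow_le_pow_left' (min_le_right _ _) 2
    _ = (n : ℝ≥0∞) ^ 2 := by simp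

theorem truncET_le_ET (n : ℕ) (x : I) : c.truncET n x ≤ c.ET x c.root :=
  lintegral_mono fun _ => min_le_left _ _

theorem truncET2_le_ET2 (n : ℕ) (x : I) : c.truncET2 n x ≤ c.ET2 x c.root :=
  lintegral_mono fun _ => pow_le_pow_left' (min_le_left _ _) 2

theorem iSup_min_natCast (t : ℝ≥0∞) : ⨆ n : ℕ, min t n = t := by
  rw [← inf_iSup_eq, ENNReal.iSup_natCast, inf_top_eq]

theorem ET_eq_iSup [Countable I] (x : I) : c.ET x c.root = ⨆ n, c.truncET n x := by
  have := c.measurableSingletonClass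
  have hT : Measurable (hitTime c.root) := measurable_hitTime c.root
  unfold truncET
  rw [← lintegral_iSup (fun n => hT.min measurable_const)
    (fun n m h ω => min_le_min_left _ (Nat.cast_le.2 h))]
  simp only [iSup_min_natCast, ET]

theorem ET2_eq_iSup [Countable I] (x : I) : c.ET2 x c.root = ⨆ n, c.truncET2 n x := by
  have := c.measurableSingletonClass
  have hT : Measurable (hitTime c.root) := measurable_hitTime c.root
  unfold truncET2
  rw [← lintegral_iSup (fun n => (hT.min measurable_const).pow_const 2)
    (fun n m h ω => pow_le_pow_left' (min_le_min_left _ (Nat.cast_le.2 h)) 2)]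
  simp only [← ENNReal.iSup_pow, iSup_min_natCast, ET2]

theorem min_one_add_le (t : ℝ≥0∞) (n : ℕ) : min (1 + t) (n : ℝ≥0∞) ≤ 1 + min t n := by
  rw [← min_add_add_left]
  exact min_le_min_left _ le_add_self

theorem truncET_le_step [Countable I] (n : ℕ) {x : I} (hx : x ≠ c.root) :
    c.truncET n x ≤ 1 + ∑' y, c.P x y * c.truncET n y := by
  have := c.law_prob x
  have := c.measurableSingletonClass
  have hT : Measurable (hitTime c.root) := measurable_hitTime c.root
  have h : c.truncET n x ≤ ∫⁻ ω, (1 + min (hitTime c.root (pathShift ω)) n) ∂c.law x := by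
    refine lintegral_mono_ae ?_
    filter_upwards [c.law_ae_start x] with ω hω
    rw [hitTime_of_ne (hω ▸ hx)]
    exact min_one_add_le _ _
  refine h.trans_eq ?_
  rw [lintegral_add_left measurable_const, lintegral_const, measure_univ, mul_one,
    c.lintegral_pathShift x (hT.min measurable_const)]
  rfl

theorem truncET2_le_step [Countable I] (n : ℕ) {x : I} (hx : x ≠ c.root) :
    c.truncET2 n x ≤ 2 * c.ET x c.root + ∑' y, c.P x y * c.truncET2 n y := by
  have := c.measurableSingletonClass
  have hT : Measurable (hitTime c.root) := measurable_hitTime c.root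
  have h : c.truncET2 n x ≤ ∫⁻ ω, (2 * hitTime c.root ω
      + (min (hitTime c.root (pathShift ω)) n) ^ 2) ∂c.law x := by
    refine lintegral_mono_ae ?_
    filter_upwards [c.law_ae_start x] with ω hω
    rw [hitTime_of_ne (hω ▸ hx)]
    set t := hitTime c.root (pathShift ω)
    calc (min (1 + t) (n : ℝ≥0∞)) ^ 2 ≤ (1 + min t n) ^ 2 :=
          pow_le_pow_left' (min_one_add_le t n) 2
      _ = (1 + 2 * min t n) + (min t n) ^ 2 := by ring
      _ ≤ 2 * (1 + t) + (min t n) ^ 2 := by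
        rw [mul_add]
        gcongr
        · norm_num
        · exact min_le_left _ _
  refine h.trans_eq ?_
  rw [lintegral_add_left (hT.const_mul 2), lintegral_const_mul _ hT,
    c.lintegral_pathShift x ((hT.min measurable_const).pow_const 2)]
  rfl

theorem truncET_le_par [Countable I] (n : ℕ) {x : I} (hx : x ≠ c.root) :
    c.truncET n x ≤ c.truncET n (c.par x) + c.stemTime x := by
  have h := c.le_of_le_step hx (natCast_ne_top n) (c.truncET_le n) (g := fun _ => 1)
    fun z hz => c.truncET_le_step n (c.ne_root_of_mem_branch hx hz)
  rwa [c.branchSum_const, mul_one] at h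

theorem ET_le_par [Countable I] {x : I} (hx : x ≠ c.root) :
    c.ET x c.root ≤ c.ET (c.par x) c.root + c.stemTime x := by
  rw [c.ET_eq_iSup x]
  exact iSup_le fun n => (c.truncET_le_par n hx).trans (add_le_add_left (c.truncET_le_ET n _) _)

theorem branchSum_ET_le [Countable I] {x : I} (hx : x ≠ c.root) :
    c.branchSum x (fun z => c.ET z c.root)
      ≤ c.piSet (c.branch x) * (c.ET (c.par x) c.root + c.Qx x) := by
  rw [mul_add, ← c.branchSum_tsum_stemTime, ← c.branchSum_const, ← c.branchSum_add]
  exact c.branchSum_mono fun z hz => c.le_add_tsum_stemTime hx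
    (f := fun z => c.ET z c.root) (fun w hw => c.ET_le_par (c.ne_root_of_mem_branch hx hw)) hz

theorem ET_eq_par [Countable I] {x : I} (hx : x ≠ c.root)
    (hpar : c.ET (c.par x) c.root ≠ ∞) (hQ : c.Qx x ≠ ∞) :
    c.ET x c.root = c.ET (c.par x) c.root + c.stemTime x := by
  have hfin : c.branchSum x (fun z => c.ET z c.root) ≠ ∞ :=
    ne_top_of_le_ne_top (mul_ne_top (c.piSet_ne_top _) (add_ne_top.2 ⟨hpar, hQ⟩))
      (c.branchSum_ET_le hx)
  have h := c.eq_of_eq_step hx hfin (g := fun _ => 1)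
    fun z hz => c.ET_eq_step (c.ne_root_of_mem_branch hx hz)
  rwa [c.branchSum_const, mul_one] at h

theorem ET2_le_par [Countable I] {x : I} (hx : x ≠ c.root) :
    c.ET2 x c.root ≤ c.ET2 (c.par x) c.root
      + 2 * c.stemTime x * (c.ET (c.par x) c.root + c.Qx x) := by
  rw [c.ET2_eq_iSup x]
  refine iSup_le fun n => ?_
  have h := c.le_of_le_step hx (pow_ne_top (natCast_ne_top n)) (c.truncET2_le n)
    (g := fun z => 2 * c.ET z c.root)
    fun z hz => c.truncET2_le_step n (c.ne_root_of_mem_branch hx hz)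
  refine h.trans (add_le_add (c.truncET2_le_ET2 n _) ?_)
  rw [c.branchSum_const_mul]
  calc 2 * c.branchSum x (fun z => c.ET z c.root) / (c.mu x * c.invm x)
      ≤ 2 * (c.piSet (c.branch x) * (c.ET (c.par x) c.root + c.Qx x)) / (c.mu x * c.invm x) := by
        gcongr
        exact c.branchSum_ET_le hx
    _ = _ := by
        rw [stemTime]
        simp only [div_eq_mul_inv]
        ring

theorem ET_root_root [Countable I] : c.ET c.root c.root = 0 := by
  refine (lintegral_congr_ae ?_).trans lintegral_zero
  filter_upwards [c.law_ae_start c.root] with ω hω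
  exact hitTime_of_eq hω

theorem ET2_root_root [Countable I] : c.ET2 c.root c.root = 0 := by
  refine (lintegral_congr_ae ?_).trans lintegral_zero
  filter_upwards [c.law_ae_start c.root] with ω hω
  rw [hitTime_of_eq hω, zero_pow two_ne_zero]

theorem stemTime_ne_top {x : I} (hx : x ≠ c.root) : c.stemTime x ≠ ∞ :=
  div_ne_top (c.piSet_ne_top _) (c.mu_mul_invm_ne_zero hx)

/-- If `Q` bounds `Q_y` for every `y ∈ ℓ(x)`, the second moment of the hitting time of the
root from `x` exceeds the square of its mean by at most `2 Q` times its mean. -/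
theorem ET_ne_top_and_ET2_le [Countable I] {Q : ℝ≥0∞} (hQ : Q ≠ ∞) (x : I)
    (hx : ∀ j, c.par^[j] x ≠ c.root → c.Qx (c.par^[j] x) ≤ Q) :
    c.ET x c.root ≠ ∞ ∧
      c.ET2 x c.root ≤ c.ET x c.root ^ 2 + 2 * Q * c.ET x c.root := by
  induction hd : c.depth x generalizing x with
  | zero =>
    rw [c.depth_eq_zero x hd, c.ET_root_root, c.ET2_root_root]
    simp
  | succ d ih =>
    have hr : x ≠ c.root := by
      rintro rfl
      simp [c.depth_root] at hd
    have hdp := c.depth_par x hr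
    obtain ⟨hfin, hle⟩ := ih (c.par x) (fun j => hx (j + 1)) (by omega)
    have hQx : c.Qx x ≤ Q := hx 0 hr
    have hET := c.ET_eq_par hr hfin (ne_top_of_le_ne_top hQ hQx)
    refine ⟨hET ▸ add_ne_top.2 ⟨hfin, c.stemTime_ne_top hr⟩, ?_⟩
    rw [hET]
    set u := c.ET (c.par x) c.root
    set m := c.stemTime x
    calc c.ET2 x c.root ≤ c.ET2 (c.par x) c.root + 2 * m * (u + c.Qx x) := c.ET2_le_par hr
      _ ≤ (u ^ 2 + 2 * Q * u) + 2 * m * (u + Q) := by gcongr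
      _ ≤ (u ^ 2 + 2 * Q * u) + 2 * m * (u + Q) + m ^ 2 := le_self_add
      _ = (u + m) ^ 2 + 2 * Q * (u + m) := by ring

theorem ET2_le_Qsup [Countable I] (a : I) (hQ : c.Qsup a ≠ ∞) :
    c.ET2 a c.root ≤ c.ET a c.root ^ 2 + 2 * c.Qsup a * c.ET a c.root := by
  refine (c.ET_ne_top_and_ET2_le hQ a fun j hj => ?_).2
  have hlt : j < c.depth a := by
    by_contra! h
    exact hj (c.depth_eq_zero _ (by rw [c.depth_iterate_par]; omega))
  exact le_iSup₂ (f := fun x (_ : x ∈ c.pathToRoot a) => c.Qx x) _ ⟨j, hlt, rfl⟩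

theorem variance_ratio_le [Countable I] (a : I) :
    ENNReal.ofReal (variance (fun ω => c.ratio a c.root ω) (c.law a))
      ≤ 2 * c.Qsup a / c.ET a c.root := by
  have := c.law_prob a
  have := c.measurableSingletonClass
  have hT : Measurable (hitTime c.root) := measurable_hitTime c.root
  by_cases hzero : (c.ET a c.root).toReal = 0
  · have : (fun ω => c.ratio a c.root ω) = 0 := by
      funext ω
      simp [ratio, hzero]
    rw [this, variance_zero]
    simp
  obtain ⟨h0, ht⟩ : c.ET a c.root ≠ 0 ∧ c.ET a c.root ≠ ∞ := by
    simpa [ENNReal.toReal_eq_zero_iff] using hzero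
  by_cases hQ : c.Qsup a = ∞
  · rw [hQ, mul_top two_ne_zero, top_div_of_ne_top ht]
    exact le_top
  have hle := c.ET2_le_Qsup a hQ
  have hRfin : c.ET a c.root ^ 2 + 2 * c.Qsup a * c.ET a c.root ≠ ∞ := by finiteness
  have h2 : c.ET2 a c.root ≠ ∞ := ne_top_of_le_ne_top hRfin hle
  have hmem : MemLp (fun ω => (hitTime c.root ω).toReal) 2 (c.law a) := by
    refine ⟨hT.ennreal_toReal.aestronglyMeasurable, ?_⟩
    rw [eLpNorm_lt_top_iff_lintegral_rpow_enorm_lt_top two_ne_zero ofNat_ne_top]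
    refine lt_of_le_of_lt (lintegral_mono fun ω => ?_) h2.lt_top
    rw [Real.enorm_of_nonneg toReal_nonneg]
    norm_num
    gcongr
    exact ofReal_toReal_le
  have hfin : ∀ᵐ ω ∂c.law a, hitTime c.root ω < ∞ := ae_lt_top hT ht
  have hmean : ∫ ω, (hitTime c.root ω).toReal ∂c.law a = (c.ET a c.root).toReal :=
    integral_toReal hT.aemeasurable hfin
  have hsq : ∫ ω, (hitTime c.root ω).toReal ^ 2 ∂c.law a = (c.ET2 a c.root).toReal := by
    simp only [← toReal_pow]
    refine integral_toReal (hT.pow_const 2).aemeasurable ?_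
    filter_upwards [hfin] with ω hω
    exact pow_lt_top hω
  have hvar : variance (fun ω => c.ratio a c.root ω) (c.law a)
      = ((c.ET a c.root).toReal⁻¹) ^ 2
        * ((c.ET2 a c.root).toReal - (c.ET a c.root).toReal ^ 2) := by
    have : (fun ω => c.ratio a c.root ω)
        = fun ω => (c.ET a c.root).toReal⁻¹ * (hitTime c.root ω).toReal := by
      funext ω
      rw [ratio, div_eq_inv_mul]
    rw [this, variance_const_mul, variance_eq_sub hmem, hmean, ← hsq]
    rfl
  have hpos : 0 < (c.ET a c.root).toReal := toReal_pos h0 ht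
  have hreal := toReal_mono hRfin hle
  rw [toReal_add (by finiteness) (by finiteness), toReal_pow, toReal_mul, toReal_mul,
    toReal_ofNat] at hreal
  refine ofReal_le_of_le_toReal ?_
  rw [hvar, toReal_div, toReal_mul, toReal_ofNat, inv_pow, inv_mul_le_iff₀ (by positivity)]
  refine le_trans (sub_le_iff_le_add'.2 hreal) (le_of_eq ?_)
  field_simp

end TreeChain

/-- **Lemma 4.2**: if `Q_a/E[T^a_0] → 0` then `Var(T^a_0/E[T^a_0]) → 0`;
in fact `Var(T^a_0/E[T^a_0]) ≤ 2·Q_a/E[T^a_0]`. -/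
theorem variance_tendsto_zero_of_Qsup {I : ℕ → Type*} [∀ n, MeasurableSpace (I n)]
    [∀ n, Countable (I n)] (c : ∀ n, TreeChain (I n)) (a : ∀ n, I n)
    (hdepth : Tendsto (fun n => (c n).depth (a n)) atTop atTop)
    (hQ : Tendsto (fun n => (c n).Qsup (a n) / (c n).ET (a n) (c n).root)
      atTop (𝓝 0)) :
    Tendsto (fun n =>
        variance (fun ω => (c n).ratio (a n) (c n).root ω) ((c n).law (a n)))
      atTop (𝓝 0) ∧
    ∀ n, ENNReal.ofReal
        (variance (fun ω => (c n).ratio (a n) (c n).root ω) ((c n).law (a n)))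
      ≤ 2 * (c n).Qsup (a n) / (c n).ET (a n) (c n).root := by
  have hle := fun n => (c n).variance_ratio_le (a n)
  refine ⟨?_, hle⟩
  have hlim : Tendsto (fun n => 2 * (c n).Qsup (a n) / (c n).ET (a n) (c n).root) atTop (𝓝 0) := by
    simpa [mul_div_assoc] using ENNReal.Tendsto.const_mul hQ (Or.inr (ofNat_ne_top (n := 2)))
  have hofReal := tendsto_of_tendsto_of_tendsto_of_le_of_le tendsto_const_nhds hlim
    (fun _ => zero_le) hle
  simpa [Function.comp_def, toReal_ofReal (variance_nonneg _ _)] using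
    (ENNReal.tendsto_toReal zero_ne_top).comp hofReal
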